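/- arXiv:2201.13329 — 2 statements merged into one kernel-verified Lean document; each statement's English description precedes it below -/
import Mathlib

section
/- In the Gaussian mixture model with ε = 2η, σ ≤ 1/3, and d ≥ 3/η², the adversarial accuracy of the natural classifier f_nat is less than 1% (i.e., less than Φ(-2) where Φ is the standard normal CDF, since (1 - dη²)/(σ√(1+dη²)) ≤ -2/√(1+dη²) · ... ≤ Φ^{-1}(0.01)); formally, (1 - dη²)/(σ√(1 + dη²)) ≤ -2.33 implies A_adv(f_nat) < 0.01. -/
open MeasureTheory ProbabilityTheory ENNReal

/-- The Gaussian mixture distribution over (ℝ^{d+1}) × {±1}: labels ±1 with probability 1/2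
each; given y, the coordinates are independent with x_i ~ N(μ_i y, σ²). -/
noncomputable def gmix (d : ℕ) (μ : Fin (d + 1) → ℝ) (σ : ℝ) :
    Measure ((Fin (d + 1) → ℝ) × ℝ) :=
  (1 / 2 : ℝ≥0∞) • Measure.map (fun x => (x, (1 : ℝ)))
      (Measure.pi fun i => gaussianReal (μ i) (σ ^ 2).toNNReal)
  + (1 / 2 : ℝ≥0∞) • Measure.map (fun x => (x, (-1 : ℝ)))
      (Measure.pi fun i => gaussianReal (-μ i) (σ ^ 2).toNNReal)

/-- Adversarial accuracy of a classifier f under ℓ∞ perturbations of magnitude ε. -/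
noncomputable def advAcc (d : ℕ) (D : Measure ((Fin (d + 1) → ℝ) × ℝ))
    (f : (Fin (d + 1) → ℝ) → ℝ) (ε : ℝ) : ℝ≥0∞ :=
  D {p | ∀ δ : Fin (d + 1) → ℝ, (∀ i, |δ i| ≤ ε) → f (p.1 + δ) = p.2}


theorem gaussianReal_zero_one_Ici_three_lt : gaussianReal 0 1 (Set.Ici 3) < 1 / 100 := by
  have hintegrable : IntegrableOn (fun x : ℝ => Real.exp (9 / 2) * Real.exp (-3 * x)) (Set.Ioi 3) :=
    (integrableOn_exp_mul_Ioi (by norm_num) 3).const_mul _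
  have hbound : ∫ x in Set.Ici (3 : ℝ), gaussianPDFReal 0 1 x
      ≤ ∫ x in Set.Ioi (3 : ℝ), Real.exp (9 / 2) * Real.exp (-3 * x) := by
    rw [integral_Ici_eq_integral_Ioi]
    refine integral_mono (integrable_gaussianPDFReal 0 1).integrableOn hintegrable fun x => ?_
    have hsqrt : (Real.sqrt (2 * Real.pi * (1 : NNReal)))⁻¹ ≤ 1 := by
      refine inv_le_one_of_one_le₀ (Real.one_le_sqrt.2 ?_)
      push_cast
      linarith [Real.pi_gt_three]
    simp only [gaussianPDFReal]
    rw [← Real.exp_add]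
    refine (mul_le_of_le_one_left (Real.exp_nonneg _) hsqrt).trans (Real.exp_le_exp.2 ?_)
    push_cast
    nlinarith [sq_nonneg (x - 3)]
  rw [integral_const_mul, integral_exp_mul_Ioi (by norm_num)] at hbound
  have hexp : Real.exp (9 / 2) * (-Real.exp (-3 * 3) / -3) < 1 / 100 := by
    have h1 : Real.exp (9 / 2) * Real.exp (-3 * 3) = (Real.exp (9 / 2))⁻¹ := by
      rw [← Real.exp_add, ← Real.exp_neg]
      norm_num
    have h2 : (34 : ℝ) < Real.exp (9 / 2) := by
      have h3 : Real.exp 4 = Real.exp 1 ^ 4 := by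
        rw [← Real.exp_nat_mul]
        norm_num
      calc (34 : ℝ) < 2.7 ^ 4 := by norm_num
        _ ≤ Real.exp 1 ^ 4 := by
          gcongr
          linarith [Real.exp_one_gt_d9]
        _ = Real.exp 4 := h3.symm
        _ ≤ Real.exp (9 / 2) := Real.exp_le_exp.2 (by norm_num)
    have h4 : (Real.exp (9 / 2))⁻¹ < 34⁻¹ := inv_strictAnti₀ (by norm_num) h2
    rw [neg_div_neg_eq, ← mul_div_assoc, h1]
    linarith
  rw [gaussianReal_apply_eq_integral 0 one_ne_zero]
  have hcast : (1 / 100 : ℝ≥0∞) = ENNReal.ofReal (1 / 100) := by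
    rw [ENNReal.ofReal_div_of_pos (by norm_num)]
    norm_num
  rw [hcast]
  exact (ENNReal.ofReal_lt_ofReal_iff (by norm_num)).2 (hbound.trans_lt hexp)

theorem gaussianReal_Ici_lt {m s c : ℝ} (hs : 0 < s) (hc : 3 * s ≤ c - m) :
    gaussianReal m (s ^ 2).toNNReal (Set.Ici c) < 1 / 100 := by
  have hmap : gaussianReal m (s ^ 2).toNNReal = (gaussianReal 0 1).map (fun x => s * x + m) := by
    have h1 : (fun x : ℝ => s * x + m) = (fun x => x + m) ∘ (fun x => s * x) := rfl
    rw [h1, ← Measure.map_map (by fun_prop) (by fun_prop), gaussianReal_map_const_mul,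
      gaussianReal_map_add_const]
    congr 1
    · ring
    · ext
      simp [sq_nonneg]
  rw [hmap, Measure.map_apply (by fun_prop) measurableSet_Ici]
  refine (measure_mono fun x hx => ?_).trans_lt gaussianReal_zero_one_Ici_three_lt
  simp only [Set.mem_preimage, Set.mem_Ici] at hx ⊢
  by_contra! hlt
  nlinarith

theorem gaussianReal_neg_Iic_neg_lt {m s c : ℝ} (hs : 0 < s) (hc : 3 * s ≤ c - m) :
    gaussianReal (-m) (s ^ 2).toNNReal (Set.Iic (-c)) < 1 / 100 := by
  rw [← gaussianReal_map_neg, Measure.map_apply measurable_neg measurableSet_Iic]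
  simpa using gaussianReal_Ici_lt hs hc

theorem map_sum_pi_gaussianReal {ι : Type*} [Fintype ι] (m : ι → ℝ) (v : ι → NNReal) :
    (Measure.pi fun i => gaussianReal (m i) (v i)).map (fun x => ∑ i, x i)
      = gaussianReal (∑ i, m i) (∑ i, v i) := by
  refine Measure.ext_of_charFun (funext fun t => ?_)
  rw [charFun_map_sum_pi_eq_prod]
  simp only [Finset.prod_apply, charFun_gaussianReal, ← Complex.exp_sum]
  congr 1
  push_cast
  rw [Finset.sum_sub_distrib, Finset.mul_sum, Finset.sum_mul, Finset.sum_mul, Finset.sum_div]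

theorem map_weighted_sum_pi_gaussianReal {ι : Type*} [Fintype ι] (w m : ι → ℝ) (s : ℝ) :
    (Measure.pi fun i => gaussianReal (m i) (s ^ 2).toNNReal).map (fun x => ∑ i, w i * x i)
      = gaussianReal (∑ i, w i * m i) (s ^ 2 * ∑ i, w i ^ 2).toNNReal := by
  have h1 : (fun x : ι → ℝ => ∑ i, w i * x i)
      = (fun x : ι → ℝ => ∑ i, x i) ∘ (fun x i => w i * x i) := rfl
  rw [h1, ← Measure.map_map (by fun_prop) (by fun_prop), Measure.pi_map_pi (by fun_prop)]
  simp only [gaussianReal_map_const_mul]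
  rw [map_sum_pi_gaussianReal]
  congr 1
  ext
  rw [Real.coe_toNNReal _ (mul_nonneg (sq_nonneg _) (Finset.sum_nonneg fun _ _ => sq_nonneg _))]
  simp [Finset.mul_sum, sq_nonneg, mul_comm]

theorem sum_natural_weight_mul (d : ℕ) (η a b : ℝ) :
    ∑ i : Fin (d + 1), (if i = 0 then 1 else η) * (if i = 0 then a else b) = a + d * (η * b) := by
  simp [Fin.sum_univ_succ, Fin.succ_ne_zero]

theorem gmix_le {d : ℕ} {μ : Fin (d + 1) → ℝ} {σ : ℝ} {A : Set ((Fin (d + 1) → ℝ) × ℝ)}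
    {P Q : Set (Fin (d + 1) → ℝ)} (hP : MeasurableSet P) (hQ : MeasurableSet Q)
    (hAP : ∀ x, (x, 1) ∈ A → x ∈ P) (hAQ : ∀ x, (x, -1) ∈ A → x ∈ Q) :
    gmix d μ σ A ≤ 1 / 2 * (Measure.pi fun i => gaussianReal (μ i) (σ ^ 2).toNNReal) P
      + 1 / 2 * (Measure.pi fun i => gaussianReal (-μ i) (σ ^ 2).toNNReal) Q := by
  have key : ∀ (ν : Measure (Fin (d + 1) → ℝ)) (y : ℝ) (R : Set (Fin (d + 1) → ℝ)),
      MeasurableSet R → (∀ x, (x, y) ∈ A → x ∈ R) → ν.map (fun x => (x, y)) A ≤ ν R := by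
    intro ν y R hR hAR
    have hmeas : Measurable fun x : Fin (d + 1) → ℝ => (x, y) := by fun_prop
    have hsub : A ⊆ Prod.fst ⁻¹' R ∪ Prod.snd ⁻¹' {y}ᶜ := by
      rintro ⟨x, z⟩ hx
      by_cases hz : z = y
      · subst hz
        exact Or.inl (hAR x hx)
      · exact Or.inr hz
    refine (measure_mono hsub).trans ?_
    rw [Measure.map_apply hmeas ((measurable_fst hR).union
      (measurable_snd (measurableSet_singleton y).compl))]
    exact measure_mono fun x hx => by simpa using hx
  simp only [gmix, Measure.add_apply, Measure.smul_apply, smul_eq_mul]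
  gcongr
  · exact key _ 1 P hP hAP
  · exact key _ (-1) Q hQ hAQ

/-- With ε = 2η, σ ≤ 1/3 and d ≥ 3/η², if (1 - dη²)/(σ√(1 + dη²)) ≤ -2.33 then the
adversarial accuracy of the natural classifier is below 1%. -/
theorem advAcc_natural_classifier_lt_one_percent (d : ℕ) (η σ : ℝ)
    (hη : 0 < η) (hσ : 0 < σ) (hσ' : σ ≤ 1 / 3) (hd : 3 / η ^ 2 ≤ (d : ℝ))
    (h : (1 - d * η ^ 2) / (σ * Real.sqrt (1 + d * η ^ 2)) ≤ -2.33) :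
    advAcc d (gmix d (fun i => if i = 0 then 1 else η) σ)
        (fun x => if 0 < ∑ i, (if i = 0 then 1 else η) * x i then (1 : ℝ) else -1) (2 * η)
      < 1 / 100 := by
  set w : Fin (d + 1) → ℝ := fun i => if i = 0 then 1 else η with hw
  set t : ℝ := d * η ^ 2 with ht
  have ht3 : 3 ≤ t := (div_le_iff₀ (by positivity)).1 hd
  have hr2 : 2 ≤ Real.sqrt (1 + t) := Real.le_sqrt_of_sq_le (by linarith)
  have hrsq : Real.sqrt (1 + t) ^ 2 = 1 + t := Real.sq_sqrt (by linarith)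
  have hs : 0 < σ * Real.sqrt (1 + t) := by positivity
  have hc : 3 * (σ * Real.sqrt (1 + t)) ≤ 2 * t - (1 + t) := by nlinarith
  have hnorm : ∑ i, w i * w i = 1 + t := by
    rw [hw, sum_natural_weight_mul]
    ring
  have hvar : σ ^ 2 * ∑ i, w i ^ 2 = (σ * Real.sqrt (1 + t)) ^ 2 := by
    rw [mul_pow, hrsq, ← hnorm]
    simp only [sq]
  have hshift : ∀ a : ℝ, ∀ x : Fin (d + 1) → ℝ,
      ∑ i, w i * (x + (fun i => if i = 0 then 0 else a : Fin (d + 1) → ℝ)) i = ∑ i, w i * x i + d * (η * a) := by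
    intro a x
    simp only [Pi.add_apply, mul_add, Finset.sum_add_distrib]
    rw [hw, sum_natural_weight_mul, zero_add]
  have hbudget : ∀ a : ℝ, |a| ≤ 2 * η →
      ∀ i : Fin (d + 1), |(fun i : Fin (d + 1) => if i = 0 then 0 else a) i| ≤ 2 * η := by
    intro a ha i
    by_cases hi : i = 0
    · simp [hi, hη.le]
    · simpa [hi] using ha
  have hmeas : Measurable fun x : Fin (d + 1) → ℝ => ∑ i, w i * x i := by fun_prop
  have hpos : (Measure.pi fun i => gaussianReal (w i) (σ ^ 2).toNNReal)
      ((fun x => ∑ i, w i * x i) ⁻¹' Set.Ici (2 * t)) < 1 / 100 := by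
    rw [← Measure.map_apply hmeas measurableSet_Ici, map_weighted_sum_pi_gaussianReal, hnorm, hvar]
    exact gaussianReal_Ici_lt hs hc
  have hneg : (Measure.pi fun i => gaussianReal (-w i) (σ ^ 2).toNNReal)
      ((fun x => ∑ i, w i * x i) ⁻¹' Set.Iic (-(2 * t))) < 1 / 100 := by
    rw [← Measure.map_apply hmeas measurableSet_Iic, map_weighted_sum_pi_gaussianReal, hvar]
    simp only [mul_neg, Finset.sum_neg_distrib, hnorm]
    exact gaussianReal_neg_Iic_neg_lt hs hc
  refine (gmix_le (hmeas (measurableSet_Ici (a := 2 * t)))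
    (hmeas (measurableSet_Iic (a := -(2 * t)))) ?_ ?_).trans_lt ?_
  · intro x hx
    have h1 : (if 0 < ∑ i, w i * x i + d * (η * -(2 * η)) then (1 : ℝ) else -1) = 1 := by
      rw [← hshift]
      exact hx _ (hbudget _ (by rw [abs_neg, abs_of_pos (by positivity)]))
    split_ifs at h1 with h2
    · simp only [Set.mem_preimage, Set.mem_Ici]
      nlinarith
    · norm_num at h1
  · intro x hx
    have h1 : (if 0 < ∑ i, w i * x i + d * (η * (2 * η)) then (1 : ℝ) else -1) = -1 := by
      rw [← hshift]
      exact hx _ (hbudget _ (by rw [abs_of_pos (by positivity)]))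
    split_ifs at h1 with h2
    · norm_num at h1
    · simp only [Set.mem_preimage, Set.mem_Iic]
      nlinarith
  · have h2 : (1 / 2 : ℝ≥0∞) ≠ 0 := by norm_num
    have h3 : (1 / 2 : ℝ≥0∞) ≠ ∞ := by norm_num
    calc _ < (1 / 2 : ℝ≥0∞) * (1 / 100) + 1 / 2 * (1 / 100) :=
          ENNReal.add_lt_add (ENNReal.mul_lt_mul_right h2 h3 hpos)
            (ENNReal.mul_lt_mul_right h2 h3 hneg)
      _ = 1 / 100 := by
        rw [← add_mul, ENNReal.add_halves, one_mul]
end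

section
/- Let the training distribution T_adv be: y uniform on {±1}, x_1 ~ N((1-ε)y, σ²), x_i ~ N((η-ε)y, σ²) i.i.d. for i = 2,...,d+1, with η/2 ≤ ε < 1/2. Then any linear classifier f(x) = sign(w·x + b) minimizing the ℓ∞ adversarial 0-1 risk with defense budget ε on T_adv satisfies w_i = 0 for all i ≥ 2 and w_1 > 0; hence the optimal robust classifier is equivalent to f_rob(x) = sign(x_1). -/
open MeasureTheory ProbabilityTheory ENNReal

/-- The ℓ∞ adversarial 0-1 risk of the linear classifier sign(w·x + b) with budget ε. -/
noncomputable def advRisk (d : ℕ) (D : Measure ((Fin (d + 1) → ℝ) × ℝ))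
    (w : Fin (d + 1) → ℝ) (b ε : ℝ) : ℝ≥0∞ :=
  D {p | ∃ δ : Fin (d + 1) → ℝ, (∀ i, |δ i| ≤ ε) ∧
    (if 0 < (∑ i, w i * (p.1 i + δ i)) + b then (1 : ℝ) else -1) ≠ p.2}

/-- A linear functional of independent Gaussians of common variance is an affine image of a
standard Gaussian. -/
lemma map_pi_gaussianReal_linear {ι : Type*} [Fintype ι] (μ w : ι → ℝ) (σ : ℝ) :
    (Measure.pi fun i => gaussianReal (μ i) (σ ^ 2).toNNReal).map (fun x => ∑ i, w i * x i)
      = (gaussianReal 0 1).map (fun z => σ * √(∑ i, w i ^ 2) * z + ∑ i, w i * μ i) := by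
  have hR : (gaussianReal 0 1).map (fun z => σ * √(∑ i, w i ^ 2) * z + ∑ i, w i * μ i)
      = gaussianReal (∑ i, w i * μ i) (σ ^ 2 * ∑ i, w i ^ 2).toNNReal := by
    have hcomp : (fun z => σ * √(∑ i, w i ^ 2) * z + ∑ i, w i * μ i)
        = (fun z => z + ∑ i, w i * μ i) ∘ (fun z => σ * √(∑ i, w i ^ 2) * z) := rfl
    rw [hcomp, ← Measure.map_map (by fun_prop) (by fun_prop), gaussianReal_map_const_mul,
      gaussianReal_map_add_const]
    congr 1
    · ring
    · ext
      have : 0 ≤ ∑ i, w i ^ 2 := Finset.sum_nonneg fun i _ => sq_nonneg _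
      simp [mul_pow, Real.sq_sqrt this, max_eq_left (mul_nonneg (sq_nonneg σ) this)]
  rw [hR]
  have hmeas (i : ι) : Measurable fun x : ι → ℝ => w i * x i := by fun_prop
  apply Measure.ext_of_charFun
  rw [iIndepFun.charFun_map_fun_sum_eq_prod (X := fun i (x : ι → ℝ) => w i * x i)
    (fun i => (hmeas i).aemeasurable)
    (iIndepFun_pi (X := fun i (x : ℝ) => w i * x) (fun i => (measurable_const_mul (w i)).aemeasurable))]
  have hm : ∀ i, (Measure.pi fun i => gaussianReal (μ i) (σ ^ 2).toNNReal).map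
      (fun x => w i * x i) = gaussianReal (w i * μ i) (σ ^ 2 * w i ^ 2).toNNReal := by
    intro i
    have hcomp : (fun x : ι → ℝ => w i * x i) = (fun z => w i * z) ∘ Function.eval i := rfl
    rw [hcomp, ← Measure.map_map (by fun_prop) (by fun_prop),
      (measurePreserving_eval (fun i => gaussianReal (μ i) (σ ^ 2).toNNReal) i).map_eq,
      gaussianReal_map_const_mul]
    congr 1
    ext
    simp [max_eq_left (sq_nonneg σ), max_eq_left (mul_nonneg (sq_nonneg σ) (sq_nonneg (w i))),
      mul_comm]
  ext t
  have hs : 0 ≤ σ ^ 2 * ∑ i, w i ^ 2 :=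
    mul_nonneg (sq_nonneg σ) (Finset.sum_nonneg fun i _ => sq_nonneg _)
  simp only [Finset.prod_apply, hm, charFun_gaussianReal]
  rw [← Complex.exp_sum]
  congr 1
  have hcast (r : ℝ) (h : 0 ≤ r) : (((r.toNNReal : NNReal) : ℝ) : ℂ) = (r : ℂ) := by
    rw [Real.coe_toNNReal r h]
  simp only [hcast _ hs, hcast _ (mul_nonneg (sq_nonneg σ) (sq_nonneg (w _)))]
  push_cast
  rw [Finset.sum_sub_distrib, Finset.mul_sum, Finset.mul_sum, Finset.sum_mul, Finset.sum_mul,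
    Finset.sum_div]

lemma exists_perturbation_le_zero_iff {ι : Type*} [Fintype ι] (w x : ι → ℝ) (b : ℝ) {ε : ℝ}
    (hε : 0 ≤ ε) :
    (∃ δ : ι → ℝ, (∀ i, |δ i| ≤ ε) ∧ (∑ i, w i * (x i + δ i)) + b ≤ 0)
      ↔ (∑ i, w i * x i) - ε * ∑ i, |w i| + b ≤ 0 := by
  simp only [mul_add, Finset.sum_add_distrib]
  constructor
  · rintro ⟨δ, hδ, h⟩
    have : -(ε * ∑ i, |w i|) ≤ ∑ i, w i * δ i := by
      rw [Finset.mul_sum, ← Finset.sum_neg_distrib]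
      refine Finset.sum_le_sum fun i _ => ?_
      have := mul_le_mul_of_nonneg_left (hδ i) (abs_nonneg (w i))
      have := neg_abs_le (w i * δ i)
      rw [abs_mul] at this
      linarith
    linarith
  · intro h
    refine ⟨fun i => -(ε * SignType.sign (w i)), fun i => ?_, ?_⟩
    · rcases lt_trichotomy (w i) 0 with hw | hw | hw <;> simp [hw, abs_of_nonneg hε, hε]
    · have : ∑ i, w i * -(ε * SignType.sign (w i)) = -(ε * ∑ i, |w i|) := by
        rw [Finset.mul_sum, ← Finset.sum_neg_distrib]
        refine Finset.sum_congr rfl fun i _ => ?_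
        rw [← self_mul_sign (w i)]
        ring
      linarith

lemma exists_perturbation_pos_iff {ι : Type*} [Fintype ι] (w x : ι → ℝ) (b : ℝ) {ε : ℝ}
    (hε : 0 ≤ ε) :
    (∃ δ : ι → ℝ, (∀ i, |δ i| ≤ ε) ∧ 0 < (∑ i, w i * (x i + δ i)) + b)
      ↔ 0 < (∑ i, w i * x i) + ε * ∑ i, |w i| + b := by
  simp only [mul_add, Finset.sum_add_distrib]
  constructor
  · rintro ⟨δ, hδ, h⟩
    have : ∑ i, w i * δ i ≤ ε * ∑ i, |w i| := by
      rw [Finset.mul_sum]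
      refine Finset.sum_le_sum fun i _ => ?_
      have := mul_le_mul_of_nonneg_left (hδ i) (abs_nonneg (w i))
      have := le_abs_self (w i * δ i)
      rw [abs_mul] at this
      linarith
    linarith
  · intro h
    refine ⟨fun i => ε * SignType.sign (w i), fun i => ?_, ?_⟩
    · rcases lt_trichotomy (w i) 0 with hw | hw | hw <;> simp [hw, abs_of_nonneg hε, hε]
    · have : ∑ i, w i * (ε * SignType.sign (w i)) = ε * ∑ i, |w i| := by
        rw [Finset.mul_sum]
        refine Finset.sum_congr rfl fun i _ => ?_
        rw [← self_mul_sign (w i)]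
        ring
      linarith

/-- The adversarial risk on a Gaussian mixture, expressed through a standard Gaussian. -/
lemma advRisk_gmix (d : ℕ) (μ w : Fin (d + 1) → ℝ) (σ b : ℝ) {ε : ℝ} (hε : 0 ≤ ε) :
    advRisk d (gmix d μ σ) w b ε = (1 / 2 : ℝ≥0∞) *
      (gaussianReal 0 1 {z | σ * √(∑ i, w i ^ 2) * z
          + (∑ i, w i * μ i - ε * ∑ i, |w i|) + b ≤ 0}
        + gaussianReal 0 1 {z | 0 < σ * √(∑ i, w i ^ 2) * z
          - (∑ i, w i * μ i - ε * ∑ i, |w i|) + b}) := by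
  have hpos : {x : Fin (d + 1) → ℝ | ∃ δ : Fin (d + 1) → ℝ, (∀ i, |δ i| ≤ ε) ∧
      (if 0 < (∑ i, w i * (x i + δ i)) + b then (1 : ℝ) else -1) ≠ 1}
      = (fun x => ∑ i, w i * x i) ⁻¹' {y | y - ε * ∑ i, |w i| + b ≤ 0} := by
    ext x
    rw [Set.mem_preimage, Set.mem_ofPred_eq, Set.mem_ofPred_eq,
      ← exists_perturbation_le_zero_iff w x b hε]
    refine exists_congr fun δ => and_congr_right fun _ => ?_
    split_ifs with h
    · simpa using h
    · norm_num; exact not_lt.mp h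
  have hneg : {x : Fin (d + 1) → ℝ | ∃ δ : Fin (d + 1) → ℝ, (∀ i, |δ i| ≤ ε) ∧
      (if 0 < (∑ i, w i * (x i + δ i)) + b then (1 : ℝ) else -1) ≠ -1}
      = (fun x => ∑ i, w i * x i) ⁻¹' {y | 0 < y + ε * ∑ i, |w i| + b} := by
    ext x
    rw [Set.mem_preimage, Set.mem_ofPred_eq, Set.mem_ofPred_eq,
      ← exists_perturbation_pos_iff w x b hε]
    refine exists_congr fun δ => and_congr_right fun _ => ?_
    split_ifs with h
    · norm_num; exact h
    · simpa using h
  have hm1 : MeasurableSet {y : ℝ | y - ε * ∑ i, |w i| + b ≤ 0} :=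
    measurableSet_le (by fun_prop) (by fun_prop)
  have hm2 : MeasurableSet {y : ℝ | 0 < y + ε * ∑ i, |w i| + b} :=
    measurableSet_lt (by fun_prop) (by fun_prop)
  rw [advRisk, gmix, Measure.add_apply, Measure.smul_apply, Measure.smul_apply,
    (measurableEmbedding_prod_mk_right (1 : ℝ)).map_apply,
    (measurableEmbedding_prod_mk_right (-1 : ℝ)).map_apply, smul_eq_mul, smul_eq_mul, ← mul_add]
  simp only [Set.preimage_ofPred_eq]
  rw [hpos, hneg, ← Measure.map_apply (by fun_prop) hm1, ← Measure.map_apply (by fun_prop) hm2,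
    map_pi_gaussianReal_linear, map_pi_gaussianReal_linear (fun i => -μ i),
    Measure.map_apply (by fun_prop) hm1, Measure.map_apply (by fun_prop) hm2]
  congr 3
  · ext z
    simp only [Set.mem_preimage, Set.mem_ofPred_eq]
    ring_nf
  · ext z
    simp only [Set.mem_preimage, Set.mem_ofPred_eq, mul_neg, Finset.sum_neg_distrib]
    ring_nf

lemma gaussianReal_le_gaussianReal_zero {c : ℝ} {A : Set ℝ} (hA : MeasurableSet A)
    (h : ∀ x ∈ A, x ^ 2 ≤ (x - c) ^ 2) : gaussianReal c 1 A ≤ gaussianReal 0 1 A := by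
  rw [gaussianReal_apply _ one_ne_zero, gaussianReal_apply _ one_ne_zero]
  refine setLIntegral_mono' hA fun x hx => ?_
  refine ENNReal.ofReal_le_ofReal ?_
  simp only [gaussianPDFReal, sub_zero]
  have := h x hx
  gcongr

lemma gaussianReal_zero_Ioc_le {a b c : ℝ} (h : ∀ x ∈ Set.Ioc a b, x ^ 2 ≤ (x - c) ^ 2) :
    gaussianReal 0 1 (Set.Ioc (a - c) (b - c)) ≤ gaussianReal 0 1 (Set.Ioc a b) := by
  refine le_trans (le_of_eq ?_) (gaussianReal_le_gaussianReal_zero measurableSet_Ioc h)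
  have := gaussianReal_map_add_const (μ := 0) (v := 1) c
  rw [zero_add] at this
  rw [← this, Measure.map_apply (by fun_prop) measurableSet_Ioc]
  simp

/-- Sum of the two error probabilities of a threshold test between Gaussians centred
at `t` and `-t`; the threshold is `-β`. -/
noncomputable def gaussErr (t β : ℝ) : ℝ≥0∞ :=
  gaussianReal 0 1 (Set.Iic (-t - β)) + gaussianReal 0 1 (Set.Ioi (t - β))

lemma gaussErr_strictAnti (β : ℝ) : StrictAnti fun t => gaussErr t β := by
  intro t t' h
  have hpos : 0 < gaussianReal 0 1 (Set.Ioc (t - β) (t' - β)) := by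
    rw [pos_iff_ne_zero]
    intro h0
    have := gaussianReal_absolutelyContinuous' 0 (one_ne_zero) h0
    simp at this
    linarith
  have hsplit : Set.Ioi (t - β) = Set.Ioc (t - β) (t' - β) ∪ Set.Ioi (t' - β) :=
    (Set.Ioc_union_Ioi_eq_Ioi (by linarith)).symm
  refine ENNReal.add_lt_add_of_le_of_lt (measure_ne_top _ _)
    (measure_mono (Set.Iic_subset_Iic.mpr (by linarith))) ?_
  rw [hsplit, measure_union (Set.Ioc_disjoint_Ioi le_rfl) measurableSet_Ioi, add_comm]
  exact ENNReal.lt_add_right (measure_ne_top _ _) hpos.ne'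

lemma gaussErr_zero_zero : gaussErr 0 0 = 1 := by
  rw [gaussErr, neg_zero, sub_zero, ← measure_union (Set.Iic_disjoint_Ioi le_rfl)
    measurableSet_Ioi, Set.Iic_union_Ioi, measure_univ]

lemma gaussErr_zero_le {t : ℝ} (ht : 0 ≤ t) (β : ℝ) : gaussErr t 0 ≤ gaussErr t β := by
  simp only [gaussErr, sub_zero]
  rcases le_total 0 β with hβ | hβ
  · rw [← Set.Iic_union_Ioc_eq_Iic (show -t - β ≤ -t by linarith),
      ← Set.Ioc_union_Ioi_eq_Ioi (show t - β ≤ t by linarith),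
      measure_union (Set.Iic_disjoint_Ioc le_rfl) measurableSet_Ioc,
      measure_union (Set.Ioc_disjoint_Ioi le_rfl) measurableSet_Ioi, add_assoc]
    refine add_le_add le_rfl (add_le_add ?_ le_rfl)
    have := gaussianReal_zero_Ioc_le (a := t - β) (b := t) (c := 2 * t)
      (fun x hx => by nlinarith [hx.2])
    rwa [show t - β - 2 * t = -t - β by ring, show t - 2 * t = -t by ring] at this
  · rw [← Set.Iic_union_Ioc_eq_Iic (show -t ≤ -t - β by linarith),
      ← Set.Ioc_union_Ioi_eq_Ioi (show t ≤ t - β by linarith),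
      measure_union (Set.Iic_disjoint_Ioc le_rfl) measurableSet_Ioc,
      measure_union (Set.Ioc_disjoint_Ioi le_rfl) measurableSet_Ioi, add_assoc]
    refine add_le_add le_rfl (add_le_add ?_ le_rfl)
    have := gaussianReal_zero_Ioc_le (a := -t) (b := -t - β) (c := -(2 * t))
      (fun x hx => by nlinarith [hx.1])
    rwa [show -t - -(2 * t) = t by ring, show -t - β - -(2 * t) = t - β by ring] at this

/-- The worst-case margin of a nonzero linear classifier, relative to its norm, is below
the one of the robust feature unless the classifier uses only that feature. -/
lemma robust_margin_lt {d : ℕ} {η ε : ℝ} (hη : 0 < η) (hε1 : η / 2 ≤ ε) (hε2 : ε < 1 / 2)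
    (w : Fin (d + 1) → ℝ) (hw : w ≠ 0)
    (hnot : ¬ ((∀ i : Fin (d + 1), i ≠ 0 → w i = 0) ∧ 0 < w 0)) :
    ∑ i, w i * (if i = 0 then 1 - ε else η - ε) - ε * ∑ i, |w i|
      < (1 - 2 * ε) * √(∑ i, w i ^ 2) := by
  have hrest : ∑ i : Fin d, w i.succ * (η - ε) - ε * ∑ i : Fin d, |w i.succ| ≤ 0 := by
    rw [Finset.mul_sum, ← Finset.sum_sub_distrib]
    refine Finset.sum_nonpos fun i _ => ?_
    rcases abs_cases (w i.succ) with ⟨h, h'⟩ | ⟨h, h'⟩ <;> rw [h] <;> nlinarith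
  rw [Fin.sum_univ_succ, Fin.sum_univ_succ (fun i => |w i|)]
  simp only [Fin.succ_ne_zero, if_true, if_false]
  have hsqrt : |w 0| ≤ √(∑ i, w i ^ 2) := by
    apply Real.abs_le_sqrt
    exact Finset.single_le_sum (f := fun i => w i ^ 2) (fun i _ => sq_nonneg _)
      (Finset.mem_univ 0)
  by_cases hz : ∀ i : Fin (d + 1), i ≠ 0 → w i = 0
  · have hw0 : w 0 < 0 := by
      refine lt_of_le_of_ne (not_lt.mp fun h => hnot ⟨hz, h⟩) fun h => hw ?_
      ext i
      by_cases hi : i = 0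
      · rw [hi, h]; rfl
      · exact hz i hi
    have : 0 ≤ (1 - 2 * ε) * √(∑ i, w i ^ 2) :=
      mul_nonneg (by linarith) (Real.sqrt_nonneg _)
    rw [abs_of_neg hw0]
    nlinarith
  · push Not at hz
    obtain ⟨j, hj, hwj⟩ := hz
    have hlt : |w 0| < √(∑ i, w i ^ 2) := by
      apply Real.lt_sqrt_of_sq_lt
      rw [sq_abs]
      exact Finset.single_lt_sum (f := fun i => w i ^ 2) hj (Finset.mem_univ 0)
        (Finset.mem_univ j) (by positivity) (fun i _ _ => sq_nonneg _)
    have := mul_lt_mul_of_pos_left hlt (show 0 < 1 - 2 * ε by linarith)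
    have := le_abs_self (w 0)
    nlinarith

/-- On the adversarially perturbed mixture T_adv (means (1-ε, η-ε, ..., η-ε)) with
η/2 ≤ ε < 1/2, any linear classifier minimizing the ℓ∞ adversarial 0-1 risk with defense
budget ε assigns zero weight to every non-robust feature and positive weight to the robust
feature; hence it is equivalent to the robust classifier sign(x_1). -/
theorem minimizer_on_Tadv_is_robust (d : ℕ) (η σ ε : ℝ)
    (hη : 0 < η) (hσ : 0 < σ) (hε1 : η / 2 ≤ ε) (hε2 : ε < 1 / 2)
    (w : Fin (d + 1) → ℝ) (b : ℝ)
    (hmin : ∀ (w' : Fin (d + 1) → ℝ) (b' : ℝ),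
      advRisk d (gmix d (fun i => if i = 0 then 1 - ε else η - ε) σ) w b ε
        ≤ advRisk d (gmix d (fun i => if i = 0 then 1 - ε else η - ε) σ) w' b' ε) :
    (∀ i : Fin (d + 1), i ≠ 0 → w i = 0) ∧ 0 < w 0 := by
  by_contra hnot
  have hε : 0 ≤ ε := by linarith
  have ht : 0 < (1 - 2 * ε) / σ := div_pos (by linarith) hσ
  have hopt := hmin (Pi.single 0 1) 0
  refine absurd hopt (not_le.mpr ?_)
  rw [advRisk_gmix _ _ _ _ _ hε, advRisk_gmix _ _ _ _ _ hε]
  refine ENNReal.mul_lt_mul_right (by simp) (by simp) ?_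
  have hrob : gaussianReal 0 1 {z | σ * √(∑ i, (Pi.single 0 1 : Fin (d + 1) → ℝ) i ^ 2) * z
          + (∑ i, (Pi.single 0 1 : Fin (d + 1) → ℝ) i * (if i = 0 then 1 - ε else η - ε)
            - ε * ∑ i, |(Pi.single 0 1 : Fin (d + 1) → ℝ) i|) + 0 ≤ 0}
        + gaussianReal 0 1 {z | 0 < σ * √(∑ i, (Pi.single 0 1 : Fin (d + 1) → ℝ) i ^ 2) * z
          - (∑ i, (Pi.single 0 1 : Fin (d + 1) → ℝ) i * (if i = 0 then 1 - ε else η - ε)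
            - ε * ∑ i, |(Pi.single 0 1 : Fin (d + 1) → ℝ) i|) + 0}
      = gaussErr ((1 - 2 * ε) / σ) 0 := by
    simp only [Fin.sum_univ_succ, Pi.single_eq_same, ne_eq, Fin.succ_ne_zero, not_false_eq_true,
      Pi.single_eq_of_ne, gaussErr]
    congr 2
    · ext z
      simp only [Set.mem_ofPred_eq, Set.mem_Iic, ← neg_div, sub_zero, le_div_iff₀ hσ]
      simp
      constructor <;> intro h <;> linarith
    · ext z
      simp only [Set.mem_ofPred_eq, Set.mem_Ioi, sub_zero, div_lt_iff₀ hσ]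
      simp
      constructor <;> intro h <;> linarith
  rw [hrob]
  by_cases hw : w = 0
  · have h1 : gaussErr ((1 - 2 * ε) / σ) 0 < 1 := by
      rw [← gaussErr_zero_zero]
      exact gaussErr_strictAnti 0 ht
    refine h1.trans_le ?_
    rcases le_or_gt b 0 with hb | hb
    · simp [hw, hb]
    · simp [hw, hb]
  · have hN : 0 < ∑ i, w i ^ 2 := by
      obtain ⟨i, hi⟩ := Function.ne_iff.mp hw
      exact Finset.sum_pos' (fun i _ => sq_nonneg _) ⟨i, Finset.mem_univ i, sq_pos_of_ne_zero hi⟩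
    have hs : 0 < σ * √(∑ i, w i ^ 2) := mul_pos hσ (Real.sqrt_pos.mpr hN)
    have hlt := robust_margin_lt hη hε1 hε2 w hw hnot
    set m := ∑ i, w i * (if i = 0 then 1 - ε else η - ε) - ε * ∑ i, |w i|
    set s := σ * √(∑ i, w i ^ 2) with hs_def
    have hms : m / s < (1 - 2 * ε) / σ := by
      rw [div_lt_div_iff₀ hs hσ, hs_def]
      nlinarith
    calc gaussErr ((1 - 2 * ε) / σ) 0
        ≤ gaussErr ((1 - 2 * ε) / σ) (b / s) := gaussErr_zero_le ht.le _
      _ < gaussErr (m / s) (b / s) := gaussErr_strictAnti _ hms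
      _ = _ := by
        rw [gaussErr]
        congr 2
        · ext z
          simp only [Set.mem_ofPred_eq, Set.mem_Iic, ← neg_div, ← sub_div, le_div_iff₀ hs]
          constructor <;> intro h <;> linarith
        · ext z
          simp only [Set.mem_ofPred_eq, Set.mem_Ioi, ← sub_div, div_lt_iff₀ hs]
          constructor <;> intro h <;> linarith
end
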